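/- arXiv:2106.01895 — 5 statements merged into one kernel-verified Lean document; each statement's English description precedes it below -/
import Mathlib

section
/- Closed-loop sliding dynamics under the defender's aggressive indirect-cooperation law. If the defender applies a_D(t) = v_D*lambda'(t) - (v_D*sin(delta_PD(t)+delta_DP(t))*cos(delta_DP(t))/(r(t)*lambda'(t))) * aP_hat(t) + (v_D*(v_D^2 - v_P^2)*cos(delta_DP(t))^2/(r(t)^2*lambda'(t))) * [ (zeta2*|sigma2(t)|^alpha2 + xi2*|sigma2(t)|^beta2)^kappa2 + epsilon2/cos(delta_DP(t)) ] * sign(sigma2(t)), then sigma2 is differentiable on [0,infinity) and for every t >= 0, sigma2'(t) = -[ (zeta2*|sigma2(t)|^alpha2 + xi2*|sigma2(t)|^beta2)^kappa2 + epsilon2/cos(delta_DP(t)) ] * sign(sigma2(t)) - (r(t)*sin(delta_PD(t)+delta_DP(t))/((v_D^2 - v_P^2)*cos(delta_DP(t)))) * (a_P(t) - aP_hat(t)). -/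
/-- Derivative of the deviated-pursuit time-to-go along differentiable lead angles `p` (pursuer)
and `d` (defender), when the range and line-of-sight rates obey the engagement kinematics.
Here `L` is the line-of-sight rate. -/
theorem hasDerivAt_deviatedPursuit_timeToGo
    {vD vP : ℝ} (hM : vD ^ 2 - vP ^ 2 ≠ 0) {r p d : ℝ → ℝ} {t L p' d' : ℝ}
    (hr : HasDerivAt r (vP * Real.cos (p t) - vD * Real.cos (d t)) t)
    (hp : HasDerivAt p p' t) (hd : HasDerivAt d d' t)
    (hcos : Real.cos (d t) ≠ 0)
    (hL : r t * L = vP * Real.sin (p t) - vD * Real.sin (d t)) :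
    HasDerivAt (fun x => r x * (vD + vP * Real.cos (p x + d x)) /
        ((vD ^ 2 - vP ^ 2) * Real.cos (d x)))
      (-1 - r t * vP * Real.sin (p t + d t) / ((vD ^ 2 - vP ^ 2) * Real.cos (d t)) * (p' + L)
        - r t ^ 2 * L / ((vD ^ 2 - vP ^ 2) * Real.cos (d t) ^ 2) * d') t := by
  have hnum := hr.mul (((hp.add hd).cos.const_mul vP).const_add vD)
  have hden := hd.cos.const_mul (vD ^ 2 - vP ^ 2)
  refine (hnum.div hden (mul_ne_zero hM hcos)).congr_deriv ?_
  have hrange : (vP * Real.cos (p t) - vD * Real.cos (d t)) *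
      (vD + vP * Real.cos (p t + d t)) + r t * L * (vP * Real.sin (p t + d t)) =
      -((vD ^ 2 - vP ^ 2) * Real.cos (d t)) := by
    rw [hL, Real.cos_add, Real.sin_add]
    linear_combination (vP ^ 2 * Real.cos (d t)) * Real.sin_sq_add_cos_sq (p t)
      - vD * vP * Real.cos (p t) * Real.sin_sq_add_cos_sq (d t)
  have hlead : -(vP * Real.sin (p t + d t) * Real.cos (d t)) +
      (vD + vP * Real.cos (p t + d t)) * Real.sin (d t) = -(r t * L) := by
    rw [hL, Real.cos_add, Real.sin_add]
    linear_combination (-vP * Real.sin (p t)) * Real.sin_sq_add_cos_sq (d t)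
  simp only [Pi.add_apply, Pi.mul_apply]
  field_simp
  linear_combination Real.cos (d t) * hrange + r t * d' * hlead

/-- **Closed-loop sliding dynamics under the defender's aggressive
indirect-cooperation law.**  If the defender applies the stated law, then the
impact-time error `σ₂` is differentiable on `[0,∞)` and satisfies the stated
closed-loop sliding-mode equation. -/
theorem aggressive_defender_closed_loop_sliding_dynamics
    (vD vP : ℝ) (hvP : 0 < vP) (hvDP : vP < vD)
    (r lam γD γP aD aP aPhat : ℝ → ℝ)
    (hr : ∀ t, 0 ≤ t → DifferentiableAt ℝ r t)
    (hlam : ∀ t, 0 ≤ t → DifferentiableAt ℝ lam t)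
    (hγD : ∀ t, 0 ≤ t → DifferentiableAt ℝ γD t)
    (hγP : ∀ t, 0 ≤ t → DifferentiableAt ℝ γP t)
    (hrpos : ∀ t, 0 ≤ t → 0 < r t)
    (hcos : ∀ t, 0 ≤ t → 0 < Real.cos (γD t - lam t))
    (hlamne : ∀ t, 0 ≤ t → deriv lam t ≠ 0)
    (hkr : ∀ t, 0 ≤ t →
      deriv r t = vP * Real.cos (γP t - lam t) - vD * Real.cos (γD t - lam t))
    (hklam : ∀ t, 0 ≤ t →
      r t * deriv lam t = vP * Real.sin (γP t - lam t) - vD * Real.sin (γD t - lam t))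
    (hγD' : ∀ t, 0 ≤ t → deriv γD t = aD t / vD)
    (hγP' : ∀ t, 0 ≤ t → deriv γP t = aP t / vP)
    (Tf : ℝ) (σ₂ : ℝ → ℝ)
    (hσ : ∀ t, σ₂ t =
      r t * (vD + vP * Real.cos ((γP t - lam t) + (γD t - lam t))) /
        ((vD ^ 2 - vP ^ 2) * Real.cos (γD t - lam t)) - (Tf - t))
    (ζ₂ ξ₂ α₂ β₂ κ₂ ε₂ : ℝ)
    (hζ : 0 < ζ₂) (hξ : 0 < ξ₂) (hα : 0 < α₂) (hβ : 0 < β₂) (hκ : 0 < κ₂) (hε : 0 < ε₂)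
    (hlaw : ∀ t, 0 ≤ t → aD t =
      vD * deriv lam t
      - (vD * Real.sin ((γP t - lam t) + (γD t - lam t)) * Real.cos (γD t - lam t) /
          (r t * deriv lam t)) * aPhat t
      + (vD * (vD ^ 2 - vP ^ 2) * Real.cos (γD t - lam t) ^ 2 /
          (r t ^ 2 * deriv lam t)) *
        ((ζ₂ * |σ₂ t| ^ α₂ + ξ₂ * |σ₂ t| ^ β₂) ^ κ₂
          + ε₂ / Real.cos (γD t - lam t)) * Real.sign (σ₂ t)) :
    (∀ t, 0 ≤ t → DifferentiableAt ℝ σ₂ t) ∧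
    (∀ t, 0 ≤ t → deriv σ₂ t =
      -(((ζ₂ * |σ₂ t| ^ α₂ + ξ₂ * |σ₂ t| ^ β₂) ^ κ₂
          + ε₂ / Real.cos (γD t - lam t)) * Real.sign (σ₂ t))
      - (r t * Real.sin ((γP t - lam t) + (γD t - lam t)) /
          ((vD ^ 2 - vP ^ 2) * Real.cos (γD t - lam t))) * (aP t - aPhat t)) := by
  have hM : 0 < vD ^ 2 - vP ^ 2 := by nlinarith
  have key : ∀ t, 0 ≤ t → HasDerivAt σ₂
      (-(((ζ₂ * |σ₂ t| ^ α₂ + ξ₂ * |σ₂ t| ^ β₂) ^ κ₂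
          + ε₂ / Real.cos (γD t - lam t)) * Real.sign (σ₂ t))
      - (r t * Real.sin ((γP t - lam t) + (γD t - lam t)) /
          ((vD ^ 2 - vP ^ 2) * Real.cos (γD t - lam t))) * (aP t - aPhat t)) t := by
    intro t ht
    have hvD : vD ≠ 0 := (hvP.trans hvDP).ne'
    have hvP' : vP ≠ 0 := hvP.ne'
    have hM' := hM.ne'
    have hrt := (hrpos t ht).ne'
    have hct := (hcos t ht).ne'
    have hLt := hlamne t ht
    have hr' := (hr t ht).hasDerivAt
    rw [hkr t ht] at hr'
    have htgo := hasDerivAt_deviatedPursuit_timeToGo hM' hr'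
      ((hγP t ht).hasDerivAt.sub (hlam t ht).hasDerivAt)
      ((hγD t ht).hasDerivAt.sub (hlam t ht).hasDerivAt) hct (hklam t ht)
    have hσ' := htgo.sub ((hasDerivAt_id t).const_sub Tf)
    refine (hσ'.congr_of_eventuallyEq (.of_forall hσ)).congr_deriv ?_
    rw [hγD' t ht, hγP' t ht, hlaw t ht]
    simp only [Pi.sub_apply]
    generalize (ζ₂ * |σ₂ t| ^ α₂ + ξ₂ * |σ₂ t| ^ β₂) ^ κ₂
      + ε₂ / Real.cos (γD t - lam t) = Q
    field_simp
    ring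
  exact ⟨fun t ht => (key t ht).differentiableAt, fun t ht => (key t ht).deriv⟩
end

section
/- Dynamics of the deviated-pursuit time-to-go (equation (18) of the paper). Under the defender-pursuer planar engagement kinematics, the function tgo_DP(t) = r(t)*[v_D + v_P*cos(delta_PD(t)+delta_DP(t))]/((v_D^2 - v_P^2)*cos(delta_DP(t))) is differentiable and for every t >= 0, tgo_DP'(t) = -1 + r(t)^2*lambda'(t)^2/((v_D^2 - v_P^2)*cos(delta_DP(t))^2) - (r(t)^2*lambda'(t)/(v_D*(v_D^2 - v_P^2)*cos(delta_DP(t))^2))*a_D(t) - (r(t)*sin(delta_PD(t)+delta_DP(t))/((v_D^2 - v_P^2)*cos(delta_DP(t))))*a_P(t). -/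
/-- The derivative of the deviated-pursuit time-to-go at a point, under the engagement
kinematics at that point. -/
theorem hasDerivAt_deviated_pursuit_tgo {vD vP : ℝ} (hvD : 0 < vD) (hvP : 0 < vP) (hne : vD ≠ vP)
    {r lam γD γP : ℝ → ℝ} {t q aD aP : ℝ} (hcos : Real.cos (γD t - lam t) ≠ 0)
    (hr : HasDerivAt r (vP * Real.cos (γP t - lam t) - vD * Real.cos (γD t - lam t)) t)
    (hlam : HasDerivAt lam q t)
    (hq : r t * q = vP * Real.sin (γP t - lam t) - vD * Real.sin (γD t - lam t))
    (hγD : HasDerivAt γD (aD / vD) t) (hγP : HasDerivAt γP (aP / vP) t) :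
    HasDerivAt
      (fun s => r s * (vD + vP * Real.cos ((γP s - lam s) + (γD s - lam s))) /
        ((vD ^ 2 - vP ^ 2) * Real.cos (γD s - lam s)))
      (-1 + r t ^ 2 * q ^ 2 / ((vD ^ 2 - vP ^ 2) * Real.cos (γD t - lam t) ^ 2)
      - (r t ^ 2 * q / (vD * (vD ^ 2 - vP ^ 2) * Real.cos (γD t - lam t) ^ 2)) * aD
      - (r t * Real.sin ((γP t - lam t) + (γD t - lam t)) /
            ((vD ^ 2 - vP ^ 2) * Real.cos (γD t - lam t))) * aP) t := by
  have hK : vD ^ 2 - vP ^ 2 ≠ 0 := by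
    rw [sq_sub_sq]
    exact mul_ne_zero (by positivity) (sub_ne_zero.mpr hne)
  have hδD := hγD.sub hlam
  have hδP := hγP.sub hlam
  have key := (hr.mul (((hδP.add hδD).cos.const_mul vP).const_add vD)).div
    (hδD.cos.const_mul (vD ^ 2 - vP ^ 2)) (mul_ne_zero hK hcos)
  refine key.congr_deriv ?_
  simp only [Pi.add_apply, Pi.sub_apply, Pi.mul_apply]
  have hD := Real.sin_sq_add_cos_sq (γD t - lam t)
  have hP := Real.sin_sq_add_cos_sq (γP t - lam t)
  have hS := Real.sin_add (γP t - lam t) (γD t - lam t)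
  have hC := Real.cos_add (γP t - lam t) (γD t - lam t)
  generalize Real.sin (γP t - lam t + (γD t - lam t)) = S at *
  generalize Real.cos (γP t - lam t + (γD t - lam t)) = W at *
  generalize Real.sin (γD t - lam t) = sD at *
  generalize Real.cos (γD t - lam t) = cD at *
  generalize Real.sin (γP t - lam t) = sP at *
  generalize Real.cos (γP t - lam t) = cP at *
  generalize r t = R at *
  have htrans : (vD + vP * W) * sD - vP * S * cD = -(R * q) := by
    rw [hq, hS, hC]
    linear_combination -vP * sP * hD
  have hrad : (vP * cP - vD * cD) * (vD + vP * W) + R * q * (vP * S)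
      = -(vD ^ 2 - vP ^ 2) * cD := by
    rw [hq, hS, hC]
    linear_combination vP ^ 2 * cD * hP - vD * vP * cP * hD
  clear hr hδD hδP key hq hD hP hS hC
  generalize hKdef : vD ^ 2 - vP ^ 2 = K at *
  field_simp
  linear_combination vD * cD * hrad + R * (aD - vD * q) * htrans

/-- **Dynamics of the deviated-pursuit time-to-go (equation (18) of the
paper).**  Under defender-pursuer planar engagement kinematics, the function
`t_go^DP = r (v_D + v_P cos(δ_PD + δ_DP)) / ((v_D² - v_P²) cos δ_DP)` is
differentiable and satisfies the stated differential identity. -/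
theorem deviated_pursuit_tgo_dynamics
    (vD vP : ℝ) (hvD : 0 < vD) (hvP : 0 < vP) (hne : vD ≠ vP)
    (r lam γD γP aD aP : ℝ → ℝ)
    (hr : ∀ t, 0 ≤ t → DifferentiableAt ℝ r t)
    (hlam : ∀ t, 0 ≤ t → DifferentiableAt ℝ lam t)
    (hγD : ∀ t, 0 ≤ t → DifferentiableAt ℝ γD t)
    (hγP : ∀ t, 0 ≤ t → DifferentiableAt ℝ γP t)
    (hrpos : ∀ t, 0 ≤ t → 0 < r t)
    (hcos : ∀ t, 0 ≤ t → Real.cos (γD t - lam t) ≠ 0)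
    (hkr : ∀ t, 0 ≤ t →
      deriv r t = vP * Real.cos (γP t - lam t) - vD * Real.cos (γD t - lam t))
    (hklam : ∀ t, 0 ≤ t →
      r t * deriv lam t = vP * Real.sin (γP t - lam t) - vD * Real.sin (γD t - lam t))
    (hγD' : ∀ t, 0 ≤ t → deriv γD t = aD t / vD)
    (hγP' : ∀ t, 0 ≤ t → deriv γP t = aP t / vP) :
    (∀ t, 0 ≤ t → DifferentiableAt ℝ
      (fun s => r s * (vD + vP * Real.cos ((γP s - lam s) + (γD s - lam s))) /
        ((vD ^ 2 - vP ^ 2) * Real.cos (γD s - lam s))) t) ∧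
    (∀ t, 0 ≤ t → deriv
      (fun s => r s * (vD + vP * Real.cos ((γP s - lam s) + (γD s - lam s))) /
        ((vD ^ 2 - vP ^ 2) * Real.cos (γD s - lam s))) t =
      -1 + r t ^ 2 * deriv lam t ^ 2 /
            ((vD ^ 2 - vP ^ 2) * Real.cos (γD t - lam t) ^ 2)
      - (r t ^ 2 * deriv lam t /
            (vD * (vD ^ 2 - vP ^ 2) * Real.cos (γD t - lam t) ^ 2)) * aD t
      - (r t * Real.sin ((γP t - lam t) + (γD t - lam t)) /
            ((vD ^ 2 - vP ^ 2) * Real.cos (γD t - lam t))) * aP t) := by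
  have key := fun t ht => hasDerivAt_deviated_pursuit_tgo hvD hvP hne (hcos t ht)
    (hkr t ht ▸ (hr t ht).hasDerivAt) (hlam t ht).hasDerivAt (hklam t ht)
    (hγD' t ht ▸ (hγD t ht).hasDerivAt) (hγP' t ht ▸ (hγP t ht).hasDerivAt)
  exact ⟨fun t ht => (key t ht).differentiableAt, fun t ht => (key t ht).deriv⟩
end

section
/- Fixed-time Lyapunov convergence lemma (used in the proofs of Theorems 1-5). Let zeta, xi, alpha, beta, kappa > 0 satisfy alpha*kappa < 1 and beta*kappa > 1. Let V : [0,infinity) -> R be continuous with V(t) >= 0 for all t, and suppose that at every t >= 0 with V(t) > 0, V is differentiable at t with V'(t) <= -(zeta*V(t)^alpha + xi*V(t)^beta)^kappa. Then there exists t* in [0, T] with V(t*) = 0, where T = 1/(zeta^kappa*(1 - alpha*kappa)) + 1/(xi^kappa*(beta*kappa - 1)); in particular, the settling-time bound T is independent of the initial value V(0). -/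
/-- A positive function with `f' ≤ -c f ^ p`, `p ≠ 1`, satisfies the integrated inequality for
`f ^ (1 - p) / (1 - p)`. -/
theorem rpow_div_le_sub_of_deriv_le_neg_mul_rpow {f : ℝ → ℝ} {a b c p : ℝ} (hp : p ≠ 1)
    (hab : a ≤ b) (hpos : ∀ t ∈ Set.Icc a b, 0 < f t)
    (hdiff : ∀ t ∈ Set.Icc a b, DifferentiableAt ℝ f t)
    (hderiv : ∀ t ∈ Set.Icc a b, deriv f t ≤ -(c * f t ^ p)) :
    f b ^ (1 - p) / (1 - p) ≤ f a ^ (1 - p) / (1 - p) - c * (b - a) := by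
  have hp' : 1 - p ≠ 0 := sub_ne_zero.mpr hp.symm
  have hder : ∀ t ∈ Set.Icc a b,
      HasDerivAt (fun s => f s ^ (1 - p) / (1 - p)) (deriv f t * f t ^ (-p)) t := by
    intro t ht
    refine (((hdiff t ht).hasDerivAt.rpow_const (p := 1 - p)
      (Or.inl (hpos t ht).ne')).div_const (1 - p)).congr_deriv ?_
    rw [show 1 - p - 1 = -p by ring]
    field_simp
  have hmv := (convex_Icc a b).image_sub_le_mul_sub_of_deriv_le
    (f := fun s => f s ^ (1 - p) / (1 - p)) (C := -c)
    (fun t ht => (hder t ht).continuousAt.continuousWithinAt)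
    (fun t ht => (hder t (interior_subset ht)).differentiableAt.differentiableWithinAt)
    (fun t ht => by
      have ht' := interior_subset ht
      rw [(hder t ht').deriv]
      calc deriv f t * f t ^ (-p) ≤ -(c * f t ^ p) * f t ^ (-p) :=
            mul_le_mul_of_nonneg_right (hderiv t ht') (Real.rpow_nonneg (hpos t ht').le _)
        _ = -c * f t ^ (p + -p) := by rw [Real.rpow_add (hpos t ht')]; ring
        _ = -c := by simp)
    a (Set.left_mem_Icc.mpr hab) b (Set.right_mem_Icc.mpr hab) hab
  linarith

/-- **Fixed-time Lyapunov convergence lemma.**  If a continuous nonnegative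
function `V` on `[0,∞)` satisfies, wherever `V(t) > 0`,
`V'(t) ≤ -(ζ V^α + ξ V^β)^κ` with `ακ < 1 < βκ`, then `V` vanishes at some
time `t* ≤ T := 1/(ζ^κ (1-ακ)) + 1/(ξ^κ (βκ-1))`, and the settling-time bound
`T` is independent of `V(0)`. -/
theorem fixed_time_lyapunov_convergence
    (ζ ξ α β κ : ℝ)
    (hζ : 0 < ζ) (hξ : 0 < ξ) (hα : 0 < α) (hβ : 0 < β) (hκ : 0 < κ)
    (hακ : α * κ < 1) (hβκ : 1 < β * κ)
    (V : ℝ → ℝ)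
    (hcont : ContinuousOn V (Set.Ici (0 : ℝ)))
    (hnonneg : ∀ t, 0 ≤ t → 0 ≤ V t)
    (hV : ∀ t, 0 ≤ t → 0 < V t →
      DifferentiableAt ℝ V t ∧
      deriv V t ≤ -((ζ * V t ^ α + ξ * V t ^ β) ^ κ)) :
    ∃ tstar, 0 ≤ tstar ∧
      tstar ≤ 1 / (ζ ^ κ * (1 - α * κ)) + 1 / (ξ ^ κ * (β * κ - 1)) ∧
      V tstar = 0 := by
  set A := 1 / (ζ ^ κ * (1 - α * κ)) with hA
  set B := 1 / (ξ ^ κ * (β * κ - 1)) with hB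
  have hζκ : 0 < ζ ^ κ := Real.rpow_pos_of_pos hζ κ
  have hξκ : 0 < ξ ^ κ := Real.rpow_pos_of_pos hξ κ
  have hα' : 0 < 1 - α * κ := sub_pos.mpr hακ
  have hβ' : 0 < β * κ - 1 := sub_pos.mpr hβκ
  have hA0 : 0 < A := by positivity
  have hB0 : 0 < B := by positivity
  by_contra! hne
  have hpos : ∀ t, 0 ≤ t → t ≤ A + B → 0 < V t := fun t h0 hT =>
    (hnonneg t h0).lt_of_ne' (hne t h0 hT)
  have hfast := rpow_div_le_sub_of_deriv_le_neg_mul_rpow (f := V) (c := ξ ^ κ) hβκ.ne' hB0.le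
    (fun t ht => hpos t ht.1 (by linarith [ht.2]))
    (fun t ht => (hV t ht.1 (hpos t ht.1 (by linarith [ht.2]))).1)
    (fun t ht => by
      have hVt := hpos t ht.1 (by linarith [ht.2])
      refine (hV t ht.1 hVt).2.trans (neg_le_neg ?_)
      rw [Real.rpow_mul hVt.le, ← Real.mul_rpow hξ.le (by positivity)]
      exact Real.rpow_le_rpow (by positivity) (le_add_of_nonneg_left (by positivity)) hκ.le)
  have hslow := rpow_div_le_sub_of_deriv_le_neg_mul_rpow (f := V) (c := ζ ^ κ) (a := B)
    (b := A + B) hακ.ne (by linarith)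
    (fun t ht => hpos t (hB0.le.trans ht.1) ht.2)
    (fun t ht => (hV t (hB0.le.trans ht.1) (hpos t (hB0.le.trans ht.1) ht.2)).1)
    (fun t ht => by
      have hVt := hpos t (hB0.le.trans ht.1) ht.2
      refine (hV t (hB0.le.trans ht.1) hVt).2.trans (neg_le_neg ?_)
      rw [Real.rpow_mul hVt.le, ← Real.mul_rpow hζ.le (by positivity)]
      exact Real.rpow_le_rpow (by positivity) (le_add_of_nonneg_right (by positivity)) hκ.le)
  have hV0 : 0 < V 0 := hpos 0 le_rfl (by positivity)
  have hVB : 0 < V B := hpos B hB0.le (by linarith)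
  have hVT : 0 < V (A + B) := hpos (A + B) (by positivity) le_rfl
  have hVB_lt : V B < 1 := by
    have hcB : ξ ^ κ * (B - 0) = 1 / (β * κ - 1) := by rw [hB]; field_simp; simp
    have hneg : ∀ x : ℝ, x / (1 - β * κ) = -(x / (β * κ - 1)) := fun x => by
      rw [← div_neg, neg_sub]
    rw [hcB, hneg, hneg] at hfast
    have hdiv : (V 0 ^ (1 - β * κ) + 1) / (β * κ - 1) ≤ V B ^ (1 - β * κ) / (β * κ - 1) := by
      rw [add_div]; linarith
    have hle := (div_le_div_iff_of_pos_right hβ').mp hdiv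
    by_contra! hge
    linarith [Real.rpow_le_one_of_one_le_of_nonpos hge (by linarith : 1 - β * κ ≤ 0),
      Real.rpow_pos_of_pos hV0 (1 - β * κ)]
  have hcA : ζ ^ κ * (A + B - B) = 1 / (1 - α * κ) := by
    rw [add_sub_cancel_right, hA]; field_simp
  rw [hcA, ← sub_div, div_le_div_iff_of_pos_right hα'] at hslow
  linarith [Real.rpow_lt_one hVB.le hVB_lt hα', Real.rpow_pos_of_pos hVT (1 - α * κ)]
end

section
/- Finite-time Lyapunov convergence lemma. Let c > 0 and 0 < p < 1. Let V : [0,infinity) -> R be continuous with V(t) >= 0 for all t, and suppose that at every t >= 0 with V(t) > 0, V is differentiable at t with V'(t) <= -c*V(t)^p. Then there exists t* in [0, V(0)^(1-p)/(c*(1-p))] with V(t*) = 0. -/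
/-- **Finite-time Lyapunov convergence lemma.**  If a continuous nonnegative
function `V` on `[0,∞)` satisfies `V'(t) ≤ -c V(t)^p` wherever `V(t) > 0`,
with `c > 0` and `0 < p < 1`, then `V` vanishes at some time
`t* ≤ V(0)^(1-p)/(c(1-p))`. -/
theorem finite_time_lyapunov_convergence
    (c p : ℝ) (hc : 0 < c) (hp₀ : 0 < p) (hp₁ : p < 1)
    (V : ℝ → ℝ)
    (hcont : ContinuousOn V (Set.Ici (0 : ℝ)))
    (hnonneg : ∀ t, 0 ≤ t → 0 ≤ V t)
    (hV : ∀ t, 0 ≤ t → 0 < V t →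
      DifferentiableAt ℝ V t ∧ deriv V t ≤ -(c * V t ^ p)) :
    ∃ tstar, 0 ≤ tstar ∧
      tstar ≤ V 0 ^ (1 - p) / (c * (1 - p)) ∧
      V tstar = 0 := by
  have hp : 0 < 1 - p := by linarith
  have hcp : 0 < c * (1 - p) := mul_pos hc hp
  set T := V 0 ^ (1 - p) / (c * (1 - p)) with hT
  have hT₀ : 0 ≤ T := div_nonneg (Real.rpow_nonneg (hnonneg 0 le_rfl) _) hcp.le
  by_contra! hne
  have hpos : ∀ t ∈ Set.Icc 0 T, 0 < V t := fun t ht =>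
    (hnonneg t ht.1).lt_of_ne' (hne t ht.1 ht.2)
  have hderiv : ∀ t ∈ Set.Icc 0 T, HasDerivAt (fun t => V t ^ (1 - p) + c * (1 - p) * t)
      (deriv V t * (1 - p) * V t ^ (1 - p - 1) + c * (1 - p) * 1) t := fun t ht =>
    ((hV t ht.1 (hpos t ht)).1.hasDerivAt.rpow_const (Or.inl (hpos t ht).ne')).add
      ((hasDerivAt_id t).const_mul _)
  have hanti : AntitoneOn (fun t => V t ^ (1 - p) + c * (1 - p) * t) (Set.Icc 0 T) := by
    refine antitoneOn_of_deriv_nonpos (convex_Icc 0 T)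
      (fun t ht => (hderiv t ht).continuousAt.continuousWithinAt)
      (fun t ht => (hderiv t (interior_subset ht)).differentiableAt.differentiableWithinAt)
      fun t ht => ?_
    have htT := interior_subset ht
    have hVt := hpos t htT
    rw [(hderiv t htT).deriv]
    have hcancel : V t ^ p * V t ^ (1 - p - 1) = 1 := by
      rw [← Real.rpow_add hVt]
      simp
    have hle := mul_le_mul_of_nonneg_right (hV t htT.1 hVt).2
      (mul_nonneg hp.le (Real.rpow_nonneg hVt.le (1 - p - 1)))
    linear_combination hle - c * (1 - p) * hcancel
  have hle := hanti (Set.left_mem_Icc.2 hT₀) (Set.right_mem_Icc.2 hT₀) hT₀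
  have hcT : c * (1 - p) * T = V 0 ^ (1 - p) := mul_div_cancel₀ _ hcp.ne'
  have hVT := Real.rpow_pos_of_pos (hpos T (Set.right_mem_Icc.2 hT₀)) (1 - p)
  simp only [mul_zero, add_zero] at hle
  linarith
end

section
/- Uniform decrease to the unit level under a superlinear differential inequality (the first phase of the fixed-time convergence bound). Let c > 0 and q > 1. Let V : [0,infinity) -> R be continuous, and suppose that at every t >= 0 with V(t) > 1, V is differentiable at t with V'(t) <= -c*V(t)^q. Then there exists t* in [0, 1/(c*(q-1))] with V(t*) <= 1; the bound 1/(c*(q-1)) is independent of V(0). -/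
/-- **Uniform decrease to the unit level under a superlinear differential
inequality.**  If a continuous function `V` on `[0,∞)` satisfies
`V'(t) ≤ -c V(t)^q` wherever `V(t) > 1`, with `c > 0` and `q > 1`, then
`V(t*) ≤ 1` for some `t* ∈ [0, 1/(c(q-1))]`; the bound is independent of
`V(0)`. -/
theorem uniform_decrease_to_unit_level
    (c q : ℝ) (hc : 0 < c) (hq : 1 < q)
    (V : ℝ → ℝ)
    (hcont : ContinuousOn V (Set.Ici (0 : ℝ)))
    (hV : ∀ t, 0 ≤ t → 1 < V t →
      DifferentiableAt ℝ V t ∧ deriv V t ≤ -(c * V t ^ q)) :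
    ∃ tstar, 0 ≤ tstar ∧ tstar ≤ 1 / (c * (q - 1)) ∧ V tstar ≤ 1 := by
  by_contra! hlt
  set T := 1 / (c * (q - 1)) with hT
  have hq' : 0 < q - 1 := sub_pos.2 hq
  have hTpos : 0 < T := by positivity
  have hmono : MonotoneOn (fun t => V t ^ (1 - q) - c * (q - 1) * t) (Set.Icc 0 T) := by
    refine monotoneOn_of_hasDerivWithinAt_nonneg
      (f' := fun t => deriv V t * (1 - q) * V t ^ (1 - q - 1) - c * (q - 1) * 1)
      (convex_Icc 0 T) ?_ ?_ ?_
    · refine ContinuousOn.sub ?_ (by fun_prop)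
      exact (hcont.mono Set.Icc_subset_Ici_self).rpow_const fun t ht =>
        Or.inl (zero_lt_one.trans (hlt t ht.1 ht.2)).ne'
    · intro t ht
      rw [interior_Icc] at ht
      have h1 := hlt t ht.1.le ht.2.le
      exact (((hV t ht.1.le h1).1.hasDerivAt.rpow_const
        (Or.inl (zero_lt_one.trans h1).ne')).sub
          ((hasDerivAt_id t).const_mul (c * (q - 1)))).hasDerivWithinAt
    · intro t ht
      rw [interior_Icc] at ht
      have h1 := hlt t ht.1.le ht.2.le
      have hpos : 0 < V t := zero_lt_one.trans h1
      have hcancel : V t ^ q * V t ^ (1 - q - 1) = 1 := by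
        rw [← Real.rpow_add hpos]
        simp
      have hmul := mul_le_mul_of_nonneg_left (hV t ht.1.le h1).2
        (mul_nonneg hq'.le (Real.rpow_nonneg hpos.le (1 - q - 1)))
      linear_combination hmul - c * (q - 1) * hcancel
  have hle := hmono (Set.left_mem_Icc.2 hTpos.le) (Set.right_mem_Icc.2 hTpos.le) hTpos.le
  have hcT : c * (q - 1) * T = 1 := mul_one_div_cancel (by positivity)
  have h0 : 0 < V 0 ^ (1 - q) :=
    Real.rpow_pos_of_pos (zero_lt_one.trans (hlt 0 le_rfl hTpos.le)) _
  have h1 : V T ^ (1 - q) < 1 :=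
    Real.rpow_lt_one_of_one_lt_of_neg (hlt T hTpos.le le_rfl) (by linarith)
  simp only [hcT, mul_zero] at hle
  linarith
end
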